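/- Let {T_n}_{n≥1} be a d-decaying Gauss-like iterated function system. For any s > 1/d, the pressure is continuous with respect to the alphabet: P(s) = lim_{M→∞} P_M(s). -/

import Mathlib

open Set Filter Topology Metric MeasureTheory

noncomputable section

/-- The composition `T_{a_1} ∘ ⋯ ∘ T_{a_n}` of the maps along the word `ω = (a_1,…,a_n)`. -/
def chainMap (T : ℕ+ → ℝ → ℝ) {n : ℕ} (ω : Fin n → ℕ+) (x : ℝ) : ℝ :=
  (List.ofFn ω).foldr (fun i y => T i y) x

/-- The chain-rule derivative of `chainMap T ω` at `x`, computed from the candidate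
derivatives `T'` of the individual maps:
`(T_{a_1} ∘ ⋯ ∘ T_{a_n})'(x) = ∏_j T'_{a_j}(T_{a_{j+1}} ∘ ⋯ ∘ T_{a_n}(x))`. -/
def chainDeriv (T T' : ℕ+ → ℝ → ℝ) {n : ℕ} (ω : Fin n → ℕ+) (x : ℝ) : ℝ :=
  ((List.ofFn ω).foldr (fun i p => (T i p.1, T' i p.1 * p.2)) (x, (1 : ℝ))).2

/-- A `d`-decaying Gauss-like iterated function system: a family `{T_i}_{i ≥ 1}` of
`C¹` self-maps of `[0,1]` (with derivative `T'`) satisfying the conditions (i)–(v). -/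
structure GaussLikeIFS (d : ℝ) where
  one_lt_d : 1 < d
  T : ℕ+ → ℝ → ℝ
  T' : ℕ+ → ℝ → ℝ
  maps_to : ∀ i, Set.MapsTo (T i) (Set.Icc (0 : ℝ) 1) (Set.Icc (0 : ℝ) 1)
  hasDeriv : ∀ i, ∀ x ∈ Set.Icc (0 : ℝ) 1,
    HasDerivWithinAt (T i) (T' i x) (Set.Icc (0 : ℝ) 1) x
  derivCont : ∀ i, ContinuousOn (T' i) (Set.Icc (0 : ℝ) 1)
  open_set_cond : ∀ i j : ℕ+, i ≠ j →
    T i '' Set.Ioo (0 : ℝ) 1 ∩ T j '' Set.Ioo (0 : ℝ) 1 = ∅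
  covers : (⋃ i : ℕ+, T i '' Set.Icc (0 : ℝ) 1) = Set.Ico (0 : ℝ) 1
  ordered : ∀ i j : ℕ+, (∀ x ∈ Set.Ioo (0 : ℝ) 1, T i x < T j x) → i < j
  contracting : ∃ (m : ℕ) (h : ℝ), 0 < m ∧ 0 < h ∧ h < 1 ∧
    ∀ (a : Fin m → ℕ+), ∀ x ∈ Set.Icc (0 : ℝ) 1,
      0 < |chainDeriv T T' a x| ∧ |chainDeriv T T' a x| ≤ h
  decay : ∀ ε : ℝ, 0 < ε → ∃ K₁ K₂ : ℝ, 0 < K₁ ∧ 0 < K₂ ∧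
    ∀ i : ℕ+, ∃ ζ lam : ℝ,
      (∀ x ∈ Set.Icc (0 : ℝ) 1, ζ ≤ |T' i x| ∧ |T' i x| ≤ lam) ∧
      K₁ * ((i : ℕ) : ℝ) ^ (-(d + ε)) ≤ ζ ∧ ζ ≤ lam ∧
      lam ≤ K₂ * ((i : ℕ) : ℝ) ^ (-(d - ε))

namespace GaussLikeIFS

variable {d : ℝ}

/-- The `n`-th level cylinder `C[ω] = T_{a_1} ∘ ⋯ ∘ T_{a_n}([0,1])`. -/
def cyl (S : GaussLikeIFS d) {n : ℕ} (ω : Fin n → ℕ+) : Set ℝ :=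
  chainMap S.T ω '' Set.Icc 0 1

/-- The partition function `Z_n(s) = Σ_{ω ∈ ℕ^n} |C[ω]|^s`. -/
def Z (S : GaussLikeIFS d) (n : ℕ) (s : ℝ) : ℝ :=
  ∑' ω : Fin n → ℕ+, Metric.diam (S.cyl ω) ^ s

/-- `P_n(s) = (1/n) log Z_n(s)`. -/
def Pn (S : GaussLikeIFS d) (n : ℕ) (s : ℝ) : ℝ :=
  (1 / (n : ℝ)) * Real.log (S.Z n s)

/-- The restricted partition function `Z_{M,n}(s) = Σ_{ω ∈ {1,…,M}^n} |C[ω]|^s`. -/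
def ZM (S : GaussLikeIFS d) (M n : ℕ) (s : ℝ) : ℝ :=
  ∑' ω : {f : Fin n → ℕ+ // ∀ j, (f j : ℕ) ≤ M}, Metric.diam (S.cyl ω.1) ^ s

/-- `P_{M,n}(s) = (1/n) log Z_{M,n}(s)`. -/
def PMn (S : GaussLikeIFS d) (M n : ℕ) (s : ℝ) : ℝ :=
  (1 / (n : ℝ)) * Real.log (S.ZM M n s)

/-- The set `E` of points of `[0,1]` admitting a symbolic expansion `a` such that
`∏_{m=1}^k a_{n+i_m}(x)^{t_m} ≥ B^n` for infinitely many `n`.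
(Digits are indexed from `0` here, i.e. `a j` is the `(j+1)`-st digit.) -/
def Eset (S : GaussLikeIFS d) (B : ℝ) {k : ℕ} (i : Fin k → ℕ) (t : Fin k → ℝ) : Set ℝ :=
  {x | x ∈ Set.Icc (0 : ℝ) 1 ∧ ∃ a : ℕ → ℕ+,
    (∀ n : ℕ, x ∈ S.cyl (fun j : Fin n => a j.val)) ∧
    (∃ᶠ n in Filter.atTop, B ^ n ≤ ∏ m, ((a (n + i m) : ℕ) : ℝ) ^ (t m))}

end GaussLikeIFS

/-- The simplex `S = {b : b_i ≥ 0, Σ b_i t_i = 1}`. -/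
def simplexS {k : ℕ} (t : Fin k → ℝ) : Set (Fin k → ℝ) :=
  {b | (∀ i, 0 ≤ b i) ∧ ∑ i, b i * t i = 1}

/-- `A_m(b,s) = (d-1)·s·b_m + (d·s-1)·Σ_{j<m} b_j`. -/
def Am (d : ℝ) {k : ℕ} (b : Fin k → ℝ) (s : ℝ) (m : Fin k) : ℝ :=
  (d - 1) * s * b m + (d * s - 1) * ∑ j ∈ Finset.Iio m, b j

/-- `A(b,s) = max_{1 ≤ m ≤ k} A_m(b,s)`. -/
def Afun (d : ℝ) {k : ℕ} (b : Fin k → ℝ) (s : ℝ) : ℝ :=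
  ⨆ m, Am d b s m

/-- `A(s) = min_{b ∈ S} A(b,s)`. -/
def AS (d : ℝ) {k : ℕ} (t : Fin k → ℝ) (s : ℝ) : ℝ :=
  sInf ((fun b => Afun d b s) '' simplexS t)

namespace GaussLikeIFS

variable {d : ℝ}

/-- The composition of the maps of the system along a list of letters. -/
def wordMap (S : GaussLikeIFS d) (l : List ℕ+) (x : ℝ) : ℝ :=
  l.foldr (fun i y => S.T i y) x

/-- The chain-rule derivative of `wordMap`. -/
def wordDeriv (S : GaussLikeIFS d) : List ℕ+ → ℝ → ℝ
  | [], _ => 1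
  | i :: l, x => S.T' i (S.wordMap l x) * S.wordDeriv l x

theorem wordMap_append (S : GaussLikeIFS d) (l₁ l₂ : List ℕ+) (x : ℝ) :
    S.wordMap (l₁ ++ l₂) x = S.wordMap l₁ (S.wordMap l₂ x) := by
  simp [wordMap]

theorem wordMap_mapsTo (S : GaussLikeIFS d) (l : List ℕ+) :
    MapsTo (S.wordMap l) (Icc 0 1) (Icc 0 1) := by
  induction l with
  | nil => exact fun x hx => hx
  | cons i l ih => exact fun x hx => S.maps_to i (ih hx)

theorem foldr_eq_wordMap_wordDeriv (S : GaussLikeIFS d) (l : List ℕ+) (x : ℝ) :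
    l.foldr (fun i p => (S.T i p.1, S.T' i p.1 * p.2)) (x, (1 : ℝ)) =
      (S.wordMap l x, S.wordDeriv l x) := by
  induction l with
  | nil => rfl
  | cons i l ih => simp only [List.foldr_cons, ih]; rfl

theorem chainDeriv_eq (S : GaussLikeIFS d) {n : ℕ} (ω : Fin n → ℕ+) (x : ℝ) :
    chainDeriv S.T S.T' ω x = S.wordDeriv (List.ofFn ω) x := by
  simp [chainDeriv, foldr_eq_wordMap_wordDeriv]

theorem cyl_eq (S : GaussLikeIFS d) {n : ℕ} (ω : Fin n → ℕ+) :
    S.cyl ω = S.wordMap (List.ofFn ω) '' Icc 0 1 := rfl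

theorem wordMap_hasDeriv (S : GaussLikeIFS d) (l : List ℕ+) {x : ℝ} (hx : x ∈ Icc (0 : ℝ) 1) :
    HasDerivWithinAt (S.wordMap l) (S.wordDeriv l x) (Icc 0 1) x := by
  induction l with
  | nil => exact hasDerivWithinAt_id x _
  | cons i l ih =>
    exact (S.hasDeriv i _ (S.wordMap_mapsTo l hx)).comp x ih (S.wordMap_mapsTo l)

theorem abs_wordMap_sub_le (S : GaussLikeIFS d) (l : List ℕ+) {C x y : ℝ}
    (hC : ∀ z ∈ Icc (0 : ℝ) 1, |S.wordDeriv l z| ≤ C)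
    (hx : x ∈ Icc (0 : ℝ) 1) (hy : y ∈ Icc (0 : ℝ) 1) :
    |S.wordMap l x - S.wordMap l y| ≤ C * |x - y| :=
  Convex.norm_image_sub_le_of_norm_hasDerivWithin_le
    (fun _ hz => S.wordMap_hasDeriv l hz) hC (convex_Icc 0 1) hy hx

theorem mul_abs_sub_le (S : GaussLikeIFS d) (l : List ℕ+) {c x y : ℝ}
    (hc : ∀ z ∈ Icc (0 : ℝ) 1, c ≤ |S.wordDeriv l z|)
    (hx : x ∈ Icc (0 : ℝ) 1) (hy : y ∈ Icc (0 : ℝ) 1) :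
    c * |x - y| ≤ |S.wordMap l x - S.wordMap l y| := by
  wlog hxy : x < y generalizing x y
  · rcases eq_or_lt_of_le (not_lt.mp hxy) with rfl | h
    · simp
    · rw [abs_sub_comm, abs_sub_comm (S.wordMap l x)]
      exact this hy hx h
  have hsub : Icc x y ⊆ Icc 0 1 := Icc_subset_Icc hx.1 hy.2
  obtain ⟨z, hz, hzeq⟩ := exists_hasDerivAt_eq_slope (S.wordMap l) (S.wordDeriv l) hxy
    (fun z hz => ((S.wordMap_hasDeriv l (hsub hz)).continuousWithinAt).mono hsub)
    (fun z hz => (S.wordMap_hasDeriv l (hsub (Ioo_subset_Icc_self hz))).hasDerivAt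
      (Icc_mem_nhds (hx.1.trans_lt hz.1) (hz.2.trans_le hy.2)))
  have hne : y - x ≠ 0 := (sub_pos.mpr hxy).ne'
  have h : S.wordMap l y - S.wordMap l x = S.wordDeriv l z * (y - x) := by
    rw [hzeq]; field_simp
  rw [abs_sub_comm, abs_sub_comm (S.wordMap l x), h, abs_mul]
  exact mul_le_mul_of_nonneg_right (hc z (hsub (Ioo_subset_Icc_self hz))) (abs_nonneg _)

theorem isBounded_image (S : GaussLikeIFS d) (l : List ℕ+) {A : Set ℝ}
    (hA : A ⊆ Icc (0 : ℝ) 1) : Bornology.IsBounded (S.wordMap l '' A) :=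
  (isBounded_Icc (0 : ℝ) 1).subset ((S.wordMap_mapsTo l).mono_left hA).image_subset

theorem mul_diam_le (S : GaussLikeIFS d) (l : List ℕ+) {c : ℝ} (hc0 : 0 < c)
    (hc : ∀ z ∈ Icc (0 : ℝ) 1, c ≤ |S.wordDeriv l z|) {A : Set ℝ} (hA : A ⊆ Icc 0 1) :
    c * diam A ≤ diam (S.wordMap l '' A) := by
  rw [← le_div_iff₀' hc0]
  refine diam_le_of_forall_dist_le (div_nonneg diam_nonneg hc0.le) fun x hx y hy => ?_
  rw [le_div_iff₀' hc0]
  exact (S.mul_abs_sub_le l hc (hA hx) (hA hy)).trans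
    (dist_le_diam_of_mem (S.isBounded_image l hA) (mem_image_of_mem _ hx) (mem_image_of_mem _ hy))

theorem diam_cyl_le (S : GaussLikeIFS d) {n : ℕ} (ω : Fin n → ℕ+) {C : ℝ} (hC0 : 0 ≤ C)
    (hC : ∀ z ∈ Icc (0 : ℝ) 1, |S.wordDeriv (List.ofFn ω) z| ≤ C) :
    diam (S.cyl ω) ≤ C := by
  refine diam_le_of_forall_dist_le hC0 ?_
  rintro _ ⟨x, hx, rfl⟩ _ ⟨y, hy, rfl⟩
  refine (S.abs_wordMap_sub_le _ hC hx hy).trans (mul_le_of_le_one_right hC0 ?_)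
  rw [abs_le]
  constructor <;> linarith [hx.1, hx.2, hy.1, hy.2]

theorem diam_unit : diam (Icc (0 : ℝ) 1) = 1 := by
  rw [Real.diam_Icc zero_le_one]; simp

theorem cyl_append (S : GaussLikeIFS d) {m n : ℕ} (ω : Fin m → ℕ+) (τ : Fin n → ℕ+) :
    S.cyl (Fin.append ω τ) = S.wordMap (List.ofFn ω) '' S.cyl τ := by
  rw [cyl_eq, cyl_eq, List.ofFn_fin_append, image_image]
  simp_rw [wordMap_append]

theorem cyl_subset (S : GaussLikeIFS d) {n : ℕ} (ω : Fin n → ℕ+) : S.cyl ω ⊆ Icc 0 1 :=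
  (S.wordMap_mapsTo _).image_subset

theorem letter_distortion (S : GaussLikeIFS d) {ε : ℝ} (hε : 0 < ε) :
    ∃ C : ℝ, 0 ≤ C ∧ ∀ i : ℕ+, ∀ x ∈ Icc (0 : ℝ) 1, ∀ y ∈ Icc (0 : ℝ) 1,
      |S.T' i x| ≤ Real.exp (C + 2 * ε * Real.log (i : ℕ)) * |S.T' i y| := by
  obtain ⟨K₁, K₂, h1, h2, H⟩ := S.decay ε hε
  refine ⟨|Real.log (K₂ / K₁)|, abs_nonneg _, fun i x hx y hy => ?_⟩
  obtain ⟨ζ, lam, hb, hζ, -, hlam⟩ := H i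
  have hi : (0 : ℝ) < ((i : ℕ) : ℝ) := by exact_mod_cast i.pos
  have hdiv : K₂ / K₁ ≤ Real.exp |Real.log (K₂ / K₁)| := by
    rw [← Real.log_le_iff_le_exp (by positivity)]
    exact le_abs_self _
  calc |S.T' i x| ≤ K₂ * ((i : ℕ) : ℝ) ^ (-(d - ε)) := (hb x hx).2.trans hlam
    _ = K₂ / K₁ * Real.exp (2 * ε * Real.log (i : ℕ)) * (K₁ * ((i : ℕ) : ℝ) ^ (-(d + ε))) := by
      rw [Real.rpow_def_of_pos hi, Real.rpow_def_of_pos hi,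
        show Real.log (i : ℕ) * -(d - ε) =
          2 * ε * Real.log (i : ℕ) + Real.log (i : ℕ) * -(d + ε) by ring, Real.exp_add]
      field_simp
    _ ≤ Real.exp |Real.log (K₂ / K₁)| * Real.exp (2 * ε * Real.log (i : ℕ)) * |S.T' i y| := by
      have := hζ.trans (hb y hy).1
      gcongr
    _ = _ := by rw [← Real.exp_add]

theorem abs_deriv_lower (S : GaussLikeIFS d) (i : ℕ+) :
    ∃ c : ℝ, 0 < c ∧ ∀ x ∈ Icc (0 : ℝ) 1, c ≤ |S.T' i x| := by
  obtain ⟨K₁, K₂, h1, -, H⟩ := S.decay 1 one_pos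
  obtain ⟨ζ, lam, hb, hζ, -⟩ := H i
  have hi : (0 : ℝ) < ((i : ℕ) : ℝ) := by exact_mod_cast i.pos
  exact ⟨_, by positivity, fun x hx => hζ.trans (hb x hx).1⟩

theorem wordDeriv_lower (S : GaussLikeIFS d) (l : List ℕ+) :
    ∃ c : ℝ, 0 < c ∧ ∀ x ∈ Icc (0 : ℝ) 1, c ≤ |S.wordDeriv l x| := by
  induction l with
  | nil => exact ⟨1, one_pos, fun x _ => by simp [wordDeriv]⟩
  | cons i l ih =>
    obtain ⟨c, hc, h⟩ := ih
    obtain ⟨b, hb, h'⟩ := S.abs_deriv_lower i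
    refine ⟨b * c, mul_pos hb hc, fun x hx => ?_⟩
    rw [wordDeriv, abs_mul]
    exact mul_le_mul (h' _ (S.wordMap_mapsTo l hx)) (h x hx) hc.le (abs_nonneg _)

theorem diam_cyl_pos (S : GaussLikeIFS d) {n : ℕ} (ω : Fin n → ℕ+) : 0 < diam (S.cyl ω) := by
  obtain ⟨c, hc, h⟩ := S.wordDeriv_lower (List.ofFn ω)
  have := S.mul_diam_le _ hc h (le_refl (Icc (0 : ℝ) 1))
  rw [diam_unit, mul_one] at this
  exact hc.trans_le this

/-- Local distortion of a single branch, with a uniform scale and a small power loss in the letter. -/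
theorem letter_distortion_local (S : GaussLikeIFS d) {ε : ℝ} (hε : 0 < ε) :
    ∃ δ : ℝ, 0 < δ ∧ ∀ i : ℕ+, ∀ x ∈ Icc (0 : ℝ) 1, ∀ y ∈ Icc (0 : ℝ) 1, |x - y| < δ →
      |S.T' i x| ≤ Real.exp (ε + 3 * ε * Real.log (i : ℕ)) * |S.T' i y| := by
  obtain ⟨C, hC, H⟩ := S.letter_distortion hε
  obtain ⟨N, hN⟩ := ((Real.tendsto_log_atTop.comp tendsto_natCast_atTop_atTop).eventually
    (eventually_ge_atTop (C / ε))).exists_forall_of_atTop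
  have small : ∀ i ∈ Iic N.succPNat, ∀ᶠ δ in 𝓝[>] (0 : ℝ),
      ∀ x ∈ Icc (0 : ℝ) 1, ∀ y ∈ Icc (0 : ℝ) 1, |x - y| < δ →
      |S.T' i x| ≤ Real.exp ε * |S.T' i y| := by
    intro i _
    obtain ⟨c, hc, hc'⟩ := S.abs_deriv_lower i
    have hexp : 0 < Real.exp ε - 1 := by linarith [Real.add_one_lt_exp hε.ne']
    obtain ⟨δ, hδ, hu⟩ := Metric.uniformContinuousOn_iff.mp
      (isCompact_Icc.uniformContinuousOn_of_continuous (S.derivCont i)) _ (mul_pos hc hexp)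
    filter_upwards [Ioc_mem_nhdsGT hδ] with δ' hδ' x hx y hy hxy
    have h1 : |S.T' i x - S.T' i y| < c * (Real.exp ε - 1) := hu x hx y hy (hxy.trans_le hδ'.2)
    have h2 := abs_sub_abs_le_abs_sub (S.T' i x) (S.T' i y)
    nlinarith [hc' y hy]
  obtain ⟨δ, hδ, hδ0⟩ := (((Filter.eventually_all_finite (Set.finite_Iic N.succPNat)).mpr
    small).and self_mem_nhdsWithin).exists
  refine ⟨δ, hδ0, fun i x hx y hy hxy => ?_⟩
  have hlog : 0 ≤ Real.log (i : ℕ) := Real.log_natCast_nonneg _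
  rcases le_total i N.succPNat with hi | hi
  · refine (hδ i hi x hx y hy hxy).trans ?_
    gcongr
    nlinarith
  · refine (H i x hx y hy).trans ?_
    have hiN : N ≤ (i : ℕ) := (Nat.le_succ N).trans (by exact_mod_cast hi)
    have h3 : C / ε ≤ Real.log (i : ℕ) := hN _ hiN
    rw [div_le_iff₀ hε] at h3
    gcongr ?_ * _
    rw [Real.exp_le_exp]
    nlinarith

theorem exists_uniform_depth (S : GaussLikeIFS d) {δ : ℝ} (hδ : 0 < δ) :
    ∃ L : ℕ, ∀ l : List ℕ+, L ≤ l.length → ∀ x ∈ Icc (0 : ℝ) 1, ∀ y ∈ Icc (0 : ℝ) 1,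
      |S.wordMap l x - S.wordMap l y| < δ := by
  obtain ⟨m, h, hm, h0, h1, H⟩ := S.contracting
  have key : ∀ k : ℕ, ∀ l : List ℕ+, m * k ≤ l.length → ∀ x ∈ Icc (0 : ℝ) 1,
      ∀ y ∈ Icc (0 : ℝ) 1, |S.wordMap l x - S.wordMap l y| ≤ h ^ k := by
    intro k
    induction k with
    | zero =>
      intro l _ x hx y hy
      have hx' := S.wordMap_mapsTo l hx
      have hy' := S.wordMap_mapsTo l hy
      rw [pow_zero, abs_le]
      constructor <;> linarith [hx'.1, hx'.2, hy'.1, hy'.2]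
    | succ k ih =>
      intro l hl x hx y hy
      rw [Nat.mul_succ] at hl
      have hlen : (l.take m).length = m := by simp; omega
      have hofFn : List.ofFn (fun j : Fin m => (l.take m).get (j.cast hlen.symm)) = l.take m := by
        refine List.ext_get (by simp [hlen]) ?_
        intro n h₁ h₂
        simp
      have hC : ∀ z ∈ Icc (0 : ℝ) 1, |S.wordDeriv (l.take m) z| ≤ h := by
        intro z hz
        have := (H (fun j : Fin m => (l.take m).get (j.cast hlen.symm)) z hz).2
        rwa [chainDeriv_eq, hofFn] at this
      have hdrop := ih (l.drop m) (by simp; omega) x hx y hy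
      have := S.abs_wordMap_sub_le (l.take m) hC (S.wordMap_mapsTo (l.drop m) hx)
        (S.wordMap_mapsTo (l.drop m) hy)
      rw [← wordMap_append, ← wordMap_append, List.take_append_drop] at this
      rw [pow_succ']
      exact this.trans (mul_le_mul_of_nonneg_left hdrop h0.le)
  obtain ⟨k, hk⟩ := exists_pow_lt_of_lt_one hδ h1
  exact ⟨m * k, fun l hl x hx y hy => (key k l hl x hx y hy).trans_lt hk⟩

/-- Tempered distortion: the logarithmic distortion of a word grows slowly with its length and the
logarithms of its letters. -/
theorem word_distortion (S : GaussLikeIFS d) {ε : ℝ} (hε : 0 < ε) :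
    ∃ C : ℝ, ∀ l : List ℕ+, ∀ x ∈ Icc (0 : ℝ) 1, ∀ y ∈ Icc (0 : ℝ) 1,
      |S.wordDeriv l x| ≤
        Real.exp (C + ε * l.length + 3 * ε * (l.map fun i : ℕ+ => Real.log (i : ℕ)).sum) *
          |S.wordDeriv l y| := by
  obtain ⟨C, hC, H⟩ := S.letter_distortion hε
  obtain ⟨δ, hδ, Hδ⟩ := S.letter_distortion_local hε
  obtain ⟨L, hL⟩ := S.exists_uniform_depth hδ
  have key : ∀ l : List ℕ+, ∀ x ∈ Icc (0 : ℝ) 1, ∀ y ∈ Icc (0 : ℝ) 1,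
      |S.wordDeriv l x| ≤
        Real.exp (C * (min l.length L : ℕ) + ε * l.length +
          3 * ε * (l.map fun i : ℕ+ => Real.log (i : ℕ)).sum) * |S.wordDeriv l y| := by
    intro l x hx y hy
    induction l with
    | nil => simp [wordDeriv]
    | cons i l ih =>
      have hlog : 0 ≤ Real.log (i : ℕ) := Real.log_natCast_nonneg _
      have hx' := S.wordMap_mapsTo l hx
      have hy' := S.wordMap_mapsTo l hy
      have step : |S.T' i (S.wordMap l x)| ≤
          Real.exp (C * ((min (l.length + 1) L : ℕ) - (min l.length L : ℕ)) + ε +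
            3 * ε * Real.log (i : ℕ)) * |S.T' i (S.wordMap l y)| := by
        rcases le_or_gt L l.length with h | h
        · rw [min_eq_right h, min_eq_right (h.trans (Nat.le_succ _)), sub_self, mul_zero, zero_add]
          exact Hδ i _ hx' _ hy' (hL l h x hx y hy)
        · rw [min_eq_left h.le, min_eq_left (Nat.succ_le_of_lt h)]
          refine (H i _ hx' _ hy').trans ?_
          gcongr ?_ * _
          rw [Real.exp_le_exp]
          push_cast
          nlinarith
      simp only [wordDeriv, abs_mul, List.length_cons, List.map_cons, List.sum_cons]
      refine (mul_le_mul step ih (abs_nonneg _) (by positivity)).trans (le_of_eq ?_)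
      rw [mul_mul_mul_comm, ← Real.exp_add]
      congr 2
      push_cast
      ring
  refine ⟨C * L, fun l x hx y hy => (key l x hx y hy).trans ?_⟩
  gcongr
  exact min_le_right _ _

theorem abs_wordDeriv_le_prod (S : GaussLikeIFS d) {g : ℕ+ → ℝ}
    (hg : ∀ i, ∀ x ∈ Icc (0 : ℝ) 1, |S.T' i x| ≤ g i) (l : List ℕ+) {x : ℝ}
    (hx : x ∈ Icc (0 : ℝ) 1) : |S.wordDeriv l x| ≤ (l.map g).prod := by
  induction l with
  | nil => simp [wordDeriv]
  | cons i l ih =>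
    have h := hg i _ (S.wordMap_mapsTo l hx)
    simp only [wordDeriv, abs_mul, List.map_cons, List.prod_cons]
    exact mul_le_mul h ih (abs_nonneg _) ((abs_nonneg _).trans h)

theorem sum_prod_le_tsum_pow {g : ℕ+ → ℝ} (hg0 : ∀ i, 0 ≤ g i) (hg : Summable g) {n : ℕ}
    (u : Finset (Fin n → ℕ+)) : ∑ ω ∈ u, ∏ j, g (ω j) ≤ (∑' i, g i) ^ n := by
  classical
  set A : Finset ℕ+ := u.biUnion fun ω => Finset.univ.image ω with hA
  calc ∑ ω ∈ u, ∏ j, g (ω j) ≤ ∑ ω ∈ Fintype.piFinset fun _ : Fin n => A, ∏ j, g (ω j) := by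
        refine Finset.sum_le_sum_of_subset_of_nonneg (fun ω hω => ?_)
          fun ω _ _ => Finset.prod_nonneg fun j _ => hg0 _
        rw [Fintype.mem_piFinset]
        intro j
        rw [hA, Finset.mem_biUnion]
        exact ⟨ω, hω, Finset.mem_image_of_mem _ (Finset.mem_univ j)⟩
    _ = (∑ i ∈ A, g i) ^ n := by
        rw [← Finset.prod_univ_sum (fun _ : Fin n => A) fun _ i => g i]
        simp
    _ ≤ (∑' i, g i) ^ n :=
        pow_le_pow_left₀ (Finset.sum_nonneg fun i _ => hg0 i)
          (hg.sum_le_tsum A fun i _ => hg0 i) n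

/-- The logarithm of the product of the letters of a word. -/
def logWeight {n : ℕ} (ω : Fin n → ℕ+) : ℝ := ∑ j, Real.log (ω j : ℕ)

theorem logWeight_nonneg {n : ℕ} (ω : Fin n → ℕ+) : 0 ≤ logWeight ω :=
  Finset.sum_nonneg fun _ _ => Real.log_natCast_nonneg _

/-- A partition sum weighted by a small positive power of the letters still grows at most
exponentially. -/
theorem weighted_sum_le (S : GaussLikeIFS d) {s : ℝ} (hs : 1 / d < s) :
    ∃ t B : ℝ, 0 < t ∧ ∀ (n : ℕ) (u : Finset (Fin n → ℕ+)),
      ∑ ω ∈ u, diam (S.cyl ω) ^ s * Real.exp (t * logWeight ω) ≤ Real.exp (B * n) := by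
  have hd : 0 < d := one_pos.trans S.one_lt_d
  have hs0 : 0 < s := (by positivity : 0 < 1 / d).trans hs
  have hsd : 1 < s * d := (div_lt_iff₀ hd).mp hs
  set t : ℝ := (s * d - 1) / 3 with ht
  have ht0 : 0 < t := by rw [ht]; linarith
  obtain ⟨K₁, K₂, -, hK, H⟩ := S.decay (t / s) (by positivity)
  set b : ℕ+ → ℝ := fun i => K₂ * ((i : ℕ) : ℝ) ^ (-(d - t / s)) with hb
  have hb0 : ∀ i, 0 < b i := fun i => by
    have hi : (0 : ℝ) < ((i : ℕ) : ℝ) := by exact_mod_cast i.pos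
    positivity
  have hT : ∀ i, ∀ x ∈ Icc (0 : ℝ) 1, |S.T' i x| ≤ b i := fun i x hx => by
    obtain ⟨ζ, lam, h1, -, -, h2⟩ := H i
    exact (h1 x hx).2.trans h2
  set g : ℕ+ → ℝ := fun i => b i ^ s * Real.exp (t * Real.log (i : ℕ)) with hg
  have hg0 : ∀ i, 0 < g i := fun i => mul_pos (Real.rpow_pos_of_pos (hb0 i) _) (Real.exp_pos _)
  have hgeq : g = fun i : ℕ+ => K₂ ^ s * ((i : ℕ) : ℝ) ^ (-(1 + t)) := by
    funext i
    have hi : (0 : ℝ) < ((i : ℕ) : ℝ) := by exact_mod_cast i.pos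
    simp only [hg, hb]
    rw [Real.mul_rpow hK.le (by positivity), ← Real.rpow_mul hi.le, mul_comm t,
      ← Real.rpow_def_of_pos hi, mul_assoc, ← Real.rpow_add hi]
    congr 2
    field_simp
    rw [ht]
    ring
  have hsum : Summable g := by
    rw [hgeq]
    have h : Summable fun k : ℕ => (k : ℝ) ^ (-(1 + t)) :=
      Real.summable_nat_rpow.mpr (by linarith)
    exact (h.comp_injective (i := PNat.val) PNat.coe_injective).mul_left _
  have hpos : 0 < ∑' i, g i := hsum.tsum_pos (fun i => (hg0 i).le) 1 (hg0 1)
  refine ⟨t, Real.log (∑' i, g i), ht0, fun n u => ?_⟩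
  rw [mul_comm, Real.exp_nat_mul, Real.exp_log hpos]
  refine (Finset.sum_le_sum fun ω _ => ?_).trans
    (sum_prod_le_tsum_pow (fun i => (hg0 i).le) hsum u)
  have hdiam : diam (S.cyl ω) ≤ ∏ j, b (ω j) := by
    refine S.diam_cyl_le ω (Finset.prod_nonneg fun j _ => (hb0 _).le) fun z hz => ?_
    have := S.abs_wordDeriv_le_prod hT (List.ofFn ω) hz
    rwa [List.map_ofFn, List.prod_ofFn] at this
  simp only [hg]
  rw [Finset.prod_mul_distrib, Real.finsetProd_rpow _ _ fun j _ => (hb0 _).le, ← Real.exp_sum,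
    ← Finset.mul_sum]
  exact mul_le_mul_of_nonneg_right (Real.rpow_le_rpow diam_nonneg hdiam hs0.le)
    (Real.exp_pos _).le

theorem summable_diam_rpow (S : GaussLikeIFS d) {s : ℝ} (hs : 1 / d < s) (n : ℕ) :
    Summable fun ω : Fin n → ℕ+ => diam (S.cyl ω) ^ s := by
  obtain ⟨t, B, ht, H⟩ := S.weighted_sum_le hs
  refine summable_of_sum_le (fun ω => Real.rpow_nonneg diam_nonneg _)
    fun u => (Finset.sum_le_sum fun ω _ => ?_).trans (H n u)
  exact le_mul_of_one_le_right (Real.rpow_nonneg diam_nonneg _)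
    (Real.one_le_exp (mul_nonneg ht.le (logWeight_nonneg ω)))

theorem Z_pos (S : GaussLikeIFS d) {s : ℝ} (hs : 1 / d < s) (n : ℕ) : 0 < S.Z n s :=
  (S.summable_diam_rpow hs n).tsum_pos (fun _ => Real.rpow_nonneg diam_nonneg _) (fun _ => 1)
    (Real.rpow_pos_of_pos (S.diam_cyl_pos _) _)

theorem summable_diam_rpow_subtype (S : GaussLikeIFS d) {s : ℝ} (hs : 1 / d < s) (M n : ℕ) :
    Summable fun ω : {f : Fin n → ℕ+ // ∀ j, (f j : ℕ) ≤ M} => diam (S.cyl ω.1) ^ s :=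
  (S.summable_diam_rpow hs n).subtype _

theorem ZM_pos (S : GaussLikeIFS d) {s : ℝ} (hs : 1 / d < s) {M : ℕ} (hM : 1 ≤ M) (n : ℕ) :
    0 < S.ZM M n s :=
  (S.summable_diam_rpow_subtype hs M n).tsum_pos (fun _ => Real.rpow_nonneg diam_nonneg _)
    ⟨fun _ => 1, fun _ => by simpa using hM⟩ (Real.rpow_pos_of_pos (S.diam_cyl_pos _) _)

theorem PMn_le_Pn (S : GaussLikeIFS d) {s : ℝ} (hs : 1 / d < s) {M : ℕ} (hM : 1 ≤ M) (n : ℕ) :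
    S.PMn M n s ≤ S.Pn n s :=
  mul_le_mul_of_nonneg_left (Real.log_le_log (S.ZM_pos hs hM n)
    (Summable.tsum_subtype_le (fun ω : Fin n → ℕ+ => diam (S.cyl ω) ^ s)
      {f : Fin n → ℕ+ | ∀ j, (f j : ℕ) ≤ M} (fun _ => Real.rpow_nonneg diam_nonneg _)
      (S.summable_diam_rpow hs n))) (by positivity)

theorem ZM_zero (S : GaussLikeIFS d) (M : ℕ) (s : ℝ) : S.ZM M 0 s = 1 := by
  have h : ∀ ω : Fin 0 → ℕ+, diam (S.cyl ω) = 1 := fun ω => by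
    have hcyl : S.cyl ω = Icc 0 1 := image_id _
    rw [hcyl, diam_unit]
  have : Unique {f : Fin 0 → ℕ+ // ∀ j, (f j : ℕ) ≤ M} :=
    { default := ⟨Fin.elim0, fun j => j.elim0⟩
      uniq := fun f => Subtype.ext (Subsingleton.elim _ _) }
  simp [ZM, h]

/-- Prefixing words from a finite set multiplies the restricted partition function by at least the
sum of their minimal contractions. -/
theorem sum_mul_ZM_le (S : GaussLikeIFS d) {s : ℝ} (hs : 1 / d < s) {M n : ℕ}
    (F : Finset (Fin n → ℕ+)) (hF : ∀ ω ∈ F, ∀ j, (ω j : ℕ) ≤ M) (c : (Fin n → ℕ+) → ℝ)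
    (hc0 : ∀ ω ∈ F, 0 < c ω)
    (hc : ∀ ω ∈ F, ∀ z ∈ Icc (0 : ℝ) 1, c ω ≤ |S.wordDeriv (List.ofFn ω) z|) (N : ℕ) :
    (∑ ω ∈ F, c ω ^ s) * S.ZM M N s ≤ S.ZM M (n + N) s := by
  have hs0 : 0 < s := (one_div_pos.mpr (one_pos.trans S.one_lt_d)).trans hs
  have hsumN := S.summable_diam_rpow_subtype hs M N
  have hF' : Summable fun ω : F => c ω.1 ^ s := Summable.of_finite
  have hprod := hF'.mul_of_nonneg hsumN (fun ω => Real.rpow_nonneg (hc0 _ ω.2).le _)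
    fun _ => Real.rpow_nonneg diam_nonneg _
  rw [← Finset.sum_coe_sort, ← tsum_fintype (L := SummationFilter.unconditional _), ZM,
    hF'.tsum_mul_tsum hsumN hprod]
  refine hprod.tsum_le_tsum_of_inj
    (fun p => ⟨Fin.append p.1.1 p.2.1, fun j => ?_⟩) ?_
    (fun _ _ => Real.rpow_nonneg diam_nonneg _) (fun p => ?_)
    (S.summable_diam_rpow_subtype hs M (n + N))
  · refine Fin.addCases (fun i => ?_) (fun i => ?_) j
    · rw [Fin.append_left]; exact hF _ p.1.2 i
    · rw [Fin.append_right]; exact p.2.2 i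
  · intro p q hpq
    have h := (Fin.appendEquiv n N).injective
      (a₁ := (p.1.1, p.2.1)) (a₂ := (q.1.1, q.2.1)) (congrArg Subtype.val hpq)
    rw [Prod.mk.injEq] at h
    exact Prod.ext (Subtype.ext h.1) (Subtype.ext h.2)
  · rw [← Real.mul_rpow (hc0 _ p.1.2).le diam_nonneg, S.cyl_append]
    exact Real.rpow_le_rpow (mul_nonneg (hc0 _ p.1.2).le diam_nonneg)
      (S.mul_diam_le _ (hc0 _ p.1.2) (hc _ p.1.2) (S.cyl_subset _)) hs0.le

theorem log_sum_div_le (S : GaussLikeIFS d) {s : ℝ} (hs : 1 / d < s) {M n : ℕ} (hn : 0 < n)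
    (F : Finset (Fin n → ℕ+)) (hF : ∀ ω ∈ F, ∀ j, (ω j : ℕ) ≤ M) (c : (Fin n → ℕ+) → ℝ)
    (hc0 : ∀ ω ∈ F, 0 < c ω)
    (hc : ∀ ω ∈ F, ∀ z ∈ Icc (0 : ℝ) 1, c ω ≤ |S.wordDeriv (List.ofFn ω) z|)
    (hpos : 0 < ∑ ω ∈ F, c ω ^ s) {p : ℝ}
    (hp : Tendsto (fun N : ℕ => S.PMn M N s) atTop (𝓝 p)) :
    Real.log (∑ ω ∈ F, c ω ^ s) / n ≤ p := by
  set A := ∑ ω ∈ F, c ω ^ s with hA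
  have hpow : ∀ k : ℕ, A ^ k ≤ S.ZM M (n * k) s := by
    intro k
    induction k with
    | zero => simp [ZM_zero]
    | succ k ih =>
      rw [pow_succ', Nat.mul_succ, add_comm]
      exact (mul_le_mul_of_nonneg_left ih hpos.le).trans
        (S.sum_mul_ZM_le hs F hF c hc0 hc (n * k))
  refine ge_of_tendsto (hp.comp (tendsto_id.const_mul_atTop' hn)) ?_
  filter_upwards [eventually_gt_atTop 0] with k hk
  have hk' : (0 : ℝ) < k := by exact_mod_cast hk
  have hn' : (0 : ℝ) < n := by exact_mod_cast hn
  have hlog := Real.log_le_log (pow_pos hpos k) (hpow k)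
  rw [Real.log_pow] at hlog
  simp only [Function.comp, id, PMn]
  rw [one_div, ← div_eq_inv_mul, div_le_div_iff₀ hn' (by push_cast; positivity)]
  push_cast
  nlinarith

theorem exists_alphabet_pressure_ge (S : GaussLikeIFS d) {s : ℝ} (hs : 1 / d < s) {p : ℝ}
    (hp : Tendsto (fun n : ℕ => S.Pn n s) atTop (𝓝 p)) {η : ℝ} (hη : 0 < η) :
    ∃ M₀ : ℕ, ∀ M, M₀ ≤ M → ∀ q : ℝ,
      Tendsto (fun n : ℕ => S.PMn M n s) atTop (𝓝 q) → p - η ≤ q := by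
  have hs0 : 0 < s := (one_div_pos.mpr (one_pos.trans S.one_lt_d)).trans hs
  obtain ⟨t, B, ht, hB⟩ := S.weighted_sum_le hs
  set K : ℝ := |(B - p + 2) / t| with hK
  have hK0 : 0 ≤ K := abs_nonneg _
  have hKt : B - p + 2 ≤ K * t := by
    rw [← div_le_iff₀ ht]; exact le_abs_self _
  set ε : ℝ := η / (3 * s * (1 + 3 * K)) with hε
  have hε0 : 0 < ε := by positivity
  have hεs : s * (ε + 3 * ε * K) = η / 3 := by rw [hε]; field_simp
  obtain ⟨C, hC⟩ := S.word_distortion hε0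
  obtain ⟨n, hnp, hnη, hn0⟩ := (((hp.eventually (eventually_ge_nhds
    (show p - min 1 (η / 3) < p by have := lt_min one_pos (by positivity : 0 < η / 3); linarith))).and
    (((tendsto_const_div_atTop_nhds_zero_nat (s * C + Real.log 4)).eventually
      (eventually_le_nhds (by positivity : 0 < η / 3))).and (eventually_gt_atTop 0)))).exists
  have hn : (0 : ℝ) < n := by exact_mod_cast hn0
  have hn1 : (1 : ℝ) ≤ n := by exact_mod_cast hn0
  have hZ := S.Z_pos hs n
  have hlogZ : Real.log (S.Z n s) = n * S.Pn n s := by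
    rw [Pn]; field_simp
  obtain ⟨F₀, hF₀⟩ := ((S.summable_diam_rpow hs n).hasSum.eventually
    (eventually_ge_nhds (show 3 / 4 * S.Z n s < S.Z n s by linarith))).exists
  set F := F₀.filter fun ω => logWeight ω ≤ K * n with hF
  have hbad : ∑ ω ∈ F₀ with ¬ logWeight ω ≤ K * n, diam (S.cyl ω) ^ s ≤ 1 / 2 * S.Z n s := by
    have h1 : (∑ ω ∈ F₀ with ¬ logWeight ω ≤ K * n, diam (S.cyl ω) ^ s) * Real.exp (t * (K * n)) ≤
        Real.exp (B * n) := by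
      refine le_trans ?_ (hB n (F₀.filter fun ω => ¬ logWeight ω ≤ K * n))
      rw [Finset.sum_mul]
      refine Finset.sum_le_sum fun ω hω => ?_
      have := not_le.mp (Finset.mem_filter.mp hω).2
      have := Real.rpow_nonneg (diam_nonneg (s := S.cyl ω)) s
      gcongr
    rw [← le_div_iff₀ (Real.exp_pos _), ← Real.exp_sub] at h1
    have h2 : Real.exp (B * n - t * (K * n)) ≤ Real.exp (-1) * S.Z n s := by
      rw [← Real.exp_log hZ, ← Real.exp_add, Real.exp_le_exp, hlogZ]
      have h3 : p - 1 ≤ S.Pn n s := by linarith [min_le_left 1 (η / 3)]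
      nlinarith
    have h4 : Real.exp (-1) ≤ 1 / 2 := by
      rw [Real.exp_neg, one_div]
      exact inv_anti₀ two_pos (by linarith [Real.add_one_le_exp (1 : ℝ)])
    exact (h1.trans h2).trans (mul_le_mul_of_nonneg_right h4 hZ.le)
  have hgood : S.Z n s / 4 ≤ ∑ ω ∈ F, diam (S.cyl ω) ^ s := by
    have := Finset.sum_filter_add_sum_filter_not F₀ (fun ω => logWeight ω ≤ K * n)
      fun ω => diam (S.cyl ω) ^ s
    linarith
  set E : ℝ := Real.exp (C + ε * n + 3 * ε * (K * n)) with hE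
  have hE0 : 0 < E := Real.exp_pos _
  have hc : ∀ ω ∈ F, ∀ z ∈ Icc (0 : ℝ) 1,
      diam (S.cyl ω) / E ≤ |S.wordDeriv (List.ofFn ω) z| := by
    intro ω hω z hz
    rw [div_le_iff₀' hE0]
    refine S.diam_cyl_le ω (by positivity) fun x hx => (hC _ x hx z hz).trans ?_
    have hw : ((List.ofFn ω).map fun i : ℕ+ => Real.log (i : ℕ)).sum = logWeight ω := by
      rw [List.map_ofFn, List.sum_ofFn]; rfl
    have := (Finset.mem_filter.mp hω).2
    rw [hw, List.length_ofFn, hE]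
    gcongr
  have hsum : S.Z n s / 4 / E ^ s ≤ ∑ ω ∈ F, (diam (S.cyl ω) / E) ^ s := by
    simp_rw [Real.div_rpow diam_nonneg hE0.le, ← Finset.sum_div]
    gcongr
  have hpos : 0 < S.Z n s / 4 / E ^ s := by positivity
  refine ⟨F.sup fun ω => Finset.univ.sup fun j => (ω j : ℕ), fun M hM q hq => ?_⟩
  refine le_trans ?_ (S.log_sum_div_le hs hn0 F (fun ω hω j => ?_) (fun ω => diam (S.cyl ω) / E)
    (fun ω _ => div_pos (S.diam_cyl_pos ω) hE0) hc (hpos.trans_le hsum) hq)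
  · have hlog := Real.log_le_log hpos hsum
    rw [Real.log_div (by positivity) (by positivity), Real.log_div hZ.ne' (by norm_num), hlogZ,
      Real.log_rpow hE0, hE, Real.log_exp] at hlog
    rw [le_div_iff₀ hn]
    rw [div_le_iff₀ hn] at hnη
    have h3 : p - η / 3 ≤ S.Pn n s := by linarith [min_le_right 1 (η / 3)]
    have h5 : s * (C + ε * n + 3 * ε * (K * n)) = s * C + η / 3 * n := by
      rw [← hεs]; ring
    nlinarith
  · exact ((Finset.le_sup (f := fun j => (ω j : ℕ)) (Finset.mem_univ j)).trans
      (Finset.le_sup (f := fun ω : Fin n → ℕ+ => Finset.univ.sup fun j => (ω j : ℕ)) hω)).trans hM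

end GaussLikeIFS

/-- for any `s > 1/d`, the pressure is continuous with respect to the
alphabet: `P(s) = lim_{M→∞} P_M(s)`. -/
theorem pressure_alphabet_continuity {d : ℝ} (S : GaussLikeIFS d)
    (P : ℝ → ℝ)
    (hP : ∀ s : ℝ, 1 / d < s →
      Filter.Tendsto (fun n : ℕ => S.Pn n s) Filter.atTop (nhds (P s)))
    (PM : ℕ → ℝ → ℝ)
    (hPM : ∀ (M : ℕ) (s : ℝ), 1 / d < s →
      Filter.Tendsto (fun n : ℕ => S.PMn M n s) Filter.atTop (nhds (PM M s))) :
    ∀ s : ℝ, 1 / d < s →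
      Filter.Tendsto (fun M : ℕ => PM M s) Filter.atTop (nhds (P s)) := by
  intro s hs
  refine tendsto_order.mpr ⟨fun a ha => ?_, fun a ha => ?_⟩
  · obtain ⟨M₀, hM₀⟩ := S.exists_alphabet_pressure_ge hs (hP s hs) (half_pos (sub_pos.mpr ha))
    filter_upwards [eventually_ge_atTop M₀] with M hM
    linarith [hM₀ M hM _ (hPM M s hs)]
  · filter_upwards [eventually_ge_atTop 1] with M hM
    exact (le_of_tendsto_of_tendsto' (hPM M s hs) (hP s hs) fun n =>
      S.PMn_le_Pn hs hM n).trans_lt ha
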